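/- Assume the standard setup with r ≥ 2, and suppose c_{j−1} ≤ e < c_j for some 3 ≤ j ≤ r. Let j ≤ i ≤ r and assume e + s·nᵢ ≥ c_r if i < r and e + s·nᵢ ≥ c_{r−1} if i = r, where s ≥ 1 if nᵢ = 1 and s ≥ 2 is even if nᵢ ≥ 2. Then s·nᵢ + t − r + b + 1 ≤ χ_la(G(Vᵢ,s)) ≤ s·nᵢ + t − r + j. -/

import Mathlib

open Finset
open scoped Classical

namespace LocalAntimagic

variable {V : Type*}

/-- The induced vertex label: sum of the labels of edges incident to `v`. -/
noncomputable def vertexSum [Fintype V] (G : SimpleGraph V) (f : Sym2 V → ℕ) (v : V) : ℕ :=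
  ∑ e ∈ G.incidenceFinset v, f e

/-- `f` is a local antimagic labeling of `G`: a bijection from the edge set onto
`{1, …, |E|}` whose induced vertex labels distinguish adjacent vertices. -/
def IsLocalAntimagic [Fintype V] (G : SimpleGraph V) (f : Sym2 V → ℕ) : Prop :=
  Set.BijOn f G.edgeSet (Set.Icc 1 G.edgeFinset.card) ∧
  ∀ ⦃u v : V⦄, G.Adj u v → vertexSum G f u ≠ vertexSum G f v

/-- The color number `c(f)`: the number of distinct induced vertex labels. -/
noncomputable def colorCount [Fintype V] (G : SimpleGraph V) (f : Sym2 V → ℕ) : ℕ :=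
  (Finset.univ.image (vertexSum G f)).card

/-- The local antimagic chromatic number. -/
noncomputable def chiLA [Fintype V] (G : SimpleGraph V) : ℕ :=
  sInf {n | ∃ f, IsLocalAntimagic G f ∧ colorCount G f = n}

/-- A pendant vertex is a vertex of degree 1. -/
def IsPendant [Fintype V] (G : SimpleGraph V) (v : V) : Prop :=
  G.degree v = 1

/-- The number of pendant vertices of `G`. -/
noncomputable def pendantCount [Fintype V] (G : SimpleGraph V) : ℕ :=
  (Finset.univ.filter (fun v => IsPendant G v)).card

/-- `G(S, s)`: the graph obtained from `G` by attaching `s` new pendant edges to every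
vertex of `S`.  The new pendant vertex attached to `w ∈ S` via the `j`-th new edge is
`Sum.inr (w, j)`; the original graph lives on the `Sum.inl` vertices. -/
def attachPendants (G : SimpleGraph V) (S : Finset V) (s : ℕ) :
    SimpleGraph (V ⊕ (S × Fin s)) :=
  SimpleGraph.fromRel (fun a b =>
    (∃ u v : V, a = Sum.inl u ∧ b = Sum.inl v ∧ G.Adj u v) ∨
    (∃ (w : S) (j : Fin s), a = Sum.inl (w : V) ∧ b = Sum.inr (w, j)))

/-- The standard setup: `G` is a connected graph with at least `2` edges and
`χ_la(G) = t ≥ 2`; `f` is a local antimagic labeling of `G` with `c(f) = t` whose color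
classes are `Vset 1, …, Vset t` (each nonempty, with `f⁺ ≡ c i` on `Vset i`, and the
colors `c 1, …, c t` pairwise distinct); every non-pendant vertex lies in
`Vset 1 ∪ ⋯ ∪ Vset r` where `1 ≤ r ≤ t`; each `Vset i` with `r + 1 ≤ i ≤ t` is a
singleton consisting of a pendant vertex; `c 1 < c 2 < ⋯ < c r` and
`c (r+1) < c (r+2) < ⋯ < c t`. -/
structure StandardSetup [Fintype V] (G : SimpleGraph V) (f : Sym2 V → ℕ)
    (t r : ℕ) (Vset : ℕ → Finset V) (c : ℕ → ℕ) : Prop where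
  connected : G.Connected
  two_le_card_edges : 2 ≤ G.edgeFinset.card
  chiLA_eq : chiLA G = t
  two_le_t : 2 ≤ t
  antimagic : IsLocalAntimagic G f
  colorCount_eq : colorCount G f = t
  color_on_class : ∀ i ∈ Finset.Icc 1 t, ∀ v ∈ Vset i, vertexSum G f v = c i
  class_cover : ∀ v : V, ∃ i ∈ Finset.Icc 1 t, v ∈ Vset i
  class_nonempty : ∀ i ∈ Finset.Icc 1 t, (Vset i).Nonempty
  color_injective : ∀ i ∈ Finset.Icc 1 t, ∀ j ∈ Finset.Icc 1 t, i ≠ j → c i ≠ c j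
  one_le_r : 1 ≤ r
  r_le_t : r ≤ t
  nonpendant_mem : ∀ v : V, ¬ IsPendant G v → ∃ i ∈ Finset.Icc 1 r, v ∈ Vset i
  pendant_singleton : ∀ i ∈ Finset.Icc (r + 1) t, ∃ v : V, IsPendant G v ∧ Vset i = {v}
  c_strictMono_low : ∀ i j : ℕ, 1 ≤ i → i < j → j ≤ r → c i < c j
  c_strictMono_high : ∀ i j : ℕ, r + 1 ≤ i → i < j → j ≤ t → c i < c j

/-- `b`: the number of pendant vertices of `G` lying in `Vset 1 ∪ ⋯ ∪ Vset r`. -/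
noncomputable def pendantsInLow [Fintype V] (G : SimpleGraph V)
    (Vset : ℕ → Finset V) (r : ℕ) : ℕ :=
  (((Finset.Icc 1 r).biUnion Vset).filter (fun v => IsPendant G v)).card

section Labelings

variable [Fintype V] {G : SimpleGraph V} {f : Sym2 V → ℕ}

theorem vertexSum_eq_sum_ite (G : SimpleGraph V) (f : Sym2 V → ℕ) (v : V) :
    vertexSum G f v = ∑ u, if G.Adj v u then f s(v, u) else 0 := by
  rw [← Finset.sum_filter, vertexSum]
  symm
  refine Finset.sum_bij (fun u _ => s(v, u)) ?_ ?_ ?_ ?_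
  · intro u hu
    simpa [SimpleGraph.mem_incidenceFinset, SimpleGraph.mem_incidenceSet] using hu
  · intro a _ b _ h
    exact Sym2.congr_right.mp h
  · intro x hx
    rw [SimpleGraph.mem_incidenceFinset] at hx
    obtain ⟨u, rfl⟩ := Sym2.mem_iff_exists.mp hx.2
    exact ⟨u, by simpa using hx.1, rfl⟩
  · intros
    rfl

theorem degree_eq_vertexSum_one (G : SimpleGraph V) (v : V) :
    G.degree v = vertexSum G (fun _ => 1) v := by
  rw [vertexSum, Finset.sum_const, smul_eq_mul, mul_one]
  convert (G.card_incidenceFinset_eq_degree v).symm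

theorem IsPendant.exists_edge {v : V} (hv : IsPendant G v) (f : Sym2 V → ℕ) :
    ∃ x ∈ G.edgeSet, v ∈ x ∧ vertexSum G f v = f x := by
  have h : (G.incidenceFinset v).card = 1 := by
    have h' := hv
    rw [IsPendant, degree_eq_vertexSum_one, vertexSum, Finset.sum_const, smul_eq_mul,
      mul_one] at h'
    exact h'
  obtain ⟨x, hx⟩ := Finset.card_eq_one.mp h
  have hmem : x ∈ G.incidenceFinset v := by simp [hx]
  rw [SimpleGraph.mem_incidenceFinset] at hmem
  exact ⟨x, hmem.1, hmem.2, by rw [vertexSum, hx, Finset.sum_singleton]⟩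

theorem card_edgeFinset_of_bijOn {m : ℕ} (h : Set.BijOn f G.edgeSet (Set.Icc 1 m)) :
    G.edgeFinset.card = m := by
  have himage : G.edgeFinset.image f = Finset.Icc 1 m := by
    rw [← Finset.coe_inj]
    simpa using h.image_eq
  rw [← Finset.card_image_of_injOn (f := f) (by simpa using h.injOn), himage]
  simp

theorem IsLocalAntimagic.vertexSum_le (hf : IsLocalAntimagic G f) {v : V}
    (hv : IsPendant G v) : vertexSum G f v ≤ G.edgeFinset.card := by
  obtain ⟨x, hx, -, h⟩ := hv.exists_edge f
  rw [h]
  exact (hf.1.mapsTo hx).2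

theorem IsLocalAntimagic.injOn_pendant (hf : IsLocalAntimagic G f) :
    Set.InjOn (vertexSum G f) {v | IsPendant G v} := by
  intro u hu v hv huv
  obtain ⟨x, hx, hux, hxu⟩ := IsPendant.exists_edge hu f
  obtain ⟨y, hy, hvy, hyv⟩ := IsPendant.exists_edge hv f
  obtain rfl : x = y := hf.1.injOn hx hy (by rw [← hxu, ← hyv, huv])
  by_contra hne
  obtain rfl := (Sym2.mem_and_mem_iff hne).mp ⟨hux, hvy⟩
  exact hf.2 hx huv

theorem IsLocalAntimagic.exists_card_lt_vertexSum (hf : IsLocalAntimagic G f)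
    (hpos : 0 < G.edgeFinset.card) : ∃ v, G.edgeFinset.card < vertexSum G f v := by
  obtain ⟨x, hx, hfx⟩ := hf.1.surjOn (Set.right_mem_Icc.mpr hpos)
  have key : ∀ v ∈ x, vertexSum G f v ≠ f x → f x < vertexSum G f v := by
    intro v hv hne
    refine lt_of_le_of_ne ?_ hne.symm
    exact Finset.single_le_sum (f := f) (fun _ _ => Nat.zero_le _)
      ((SimpleGraph.mem_incidenceFinset _ _ _).mpr ⟨hx, hv⟩)
  induction x with
  | h a b =>
    have hab := hf.2 (show G.Adj a b from hx)
    by_cases ha : vertexSum G f a = f s(a, b)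
    · exact ⟨b, hfx ▸ key b (by simp) (fun hb => hab (ha.trans hb.symm))⟩
    · exact ⟨a, hfx ▸ key a (by simp) ha⟩

theorem IsLocalAntimagic.pendantCount_lt_colorCount (hf : IsLocalAntimagic G f)
    (hpos : 0 < G.edgeFinset.card) : pendantCount G < colorCount G f := by
  obtain ⟨a, ha⟩ := hf.exists_card_lt_vertexSum hpos
  rw [pendantCount, colorCount,
    ← Finset.card_image_of_injOn (f := vertexSum G f) (by simpa using hf.injOn_pendant)]
  refine Finset.card_lt_card (Finset.ssubset_iff_of_subset
    (Finset.image_subset_image (Finset.filter_subset _ _)) |>.mpr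
      ⟨vertexSum G f a, by simp, ?_⟩)
  simp only [Finset.mem_image, Finset.mem_filter, Finset.mem_univ, true_and, not_exists, not_and]
  intro v hv h
  have := hf.vertexSum_le hv
  omega

end Labelings

section AttachPendants

variable {G : SimpleGraph V} {S : Finset V} {s : ℕ}

@[simp]
theorem attachPendants_adj_inl_inl {u v : V} :
    (attachPendants G S s).Adj (Sum.inl u) (Sum.inl v) ↔ G.Adj u v := by
  simp only [attachPendants, SimpleGraph.fromRel_adj]
  constructor
  · rintro ⟨-, (⟨_, _, h₁, h₂, h⟩ | ⟨_, _, _, h⟩) | (⟨_, _, h₁, h₂, h⟩ | ⟨_, _, _, h⟩)⟩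
    · cases h₁; cases h₂; exact h
    · cases h
    · cases h₁; cases h₂; exact h.symm
    · cases h
  · intro h
    exact ⟨by simpa using h.ne, Or.inl (Or.inl ⟨u, v, rfl, rfl, h⟩)⟩

@[simp]
theorem attachPendants_adj_inl_inr {u : V} {p : S × Fin s} :
    (attachPendants G S s).Adj (Sum.inl u) (Sum.inr p) ↔ u = p.1 := by
  obtain ⟨w, k⟩ := p
  simp [attachPendants, SimpleGraph.fromRel_adj, eq_comm]

@[simp]
theorem attachPendants_adj_inr_inl {u : V} {p : S × Fin s} :
    (attachPendants G S s).Adj (Sum.inr p) (Sum.inl u) ↔ u = p.1 := by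
  rw [SimpleGraph.adj_comm, attachPendants_adj_inl_inr]

@[simp]
theorem attachPendants_not_adj_inr_inr {p q : S × Fin s} :
    ¬ (attachPendants G S s).Adj (Sum.inr p) (Sum.inr q) := by
  simp [attachPendants, SimpleGraph.fromRel_adj]

theorem mem_edgeSet_attachPendants {x : Sym2 (V ⊕ (S × Fin s))} :
    x ∈ (attachPendants G S s).edgeSet ↔
      (∃ y ∈ G.edgeSet, x = y.map Sum.inl) ∨ ∃ p : S × Fin s, x = s(Sum.inl ↑p.1, Sum.inr p) := by
  constructor
  · induction x with
    | h a b =>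
      rw [SimpleGraph.mem_edgeSet]
      rcases a with u | p <;> rcases b with v | q
      · intro h
        exact Or.inl ⟨s(u, v), by simpa using h, by simp⟩
      · intro h
        rw [attachPendants_adj_inl_inr] at h
        exact Or.inr ⟨q, by rw [h]⟩
      · intro h
        rw [attachPendants_adj_inr_inl] at h
        exact Or.inr ⟨p, by rw [h, Sym2.eq_swap]⟩
      · intro h
        exact absurd h attachPendants_not_adj_inr_inr
  · rintro (⟨y, hy, rfl⟩ | ⟨p, rfl⟩)
    · induction y with
      | h a b => simpa using hy
    · simp

/-- The labeling of `attachPendants G S s` that agrees with `f` on `G` and gives the pendant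
edge at `p` the label `ℓ p`. -/
def extendLabeling (f : Sym2 V → ℕ) (ℓ : S × Fin s → ℕ) : Sym2 (V ⊕ (S × Fin s)) → ℕ :=
  Sym2.lift ⟨fun a b => match a, b with
    | Sum.inl u, Sum.inl v => f s(u, v)
    | Sum.inl _, Sum.inr p => ℓ p
    | Sum.inr p, Sum.inl _ => ℓ p
    | Sum.inr _, Sum.inr _ => 0, by
      rintro (u | p) (v | q) <;> simp [Sym2.eq_swap]⟩

@[simp]
theorem extendLabeling_map_inl (f : Sym2 V → ℕ) (ℓ : S × Fin s → ℕ) (y : Sym2 V) :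
    extendLabeling f ℓ (y.map Sum.inl) = f y := by
  induction y with
  | h a b => rfl

@[simp]
theorem extendLabeling_inl_inr (f : Sym2 V → ℕ) (ℓ : S × Fin s → ℕ) (v : V) (p : S × Fin s) :
    extendLabeling f ℓ s(Sum.inl v, Sum.inr p) = ℓ p :=
  rfl

theorem bijOn_extendLabeling {f : Sym2 V → ℕ} {ℓ : S × Fin s → ℕ} {m n : ℕ}
    (hf : Set.BijOn f G.edgeSet (Set.Icc 1 m))
    (hℓ : Set.BijOn ℓ Set.univ (Set.Icc 1 n)) :
    Set.BijOn (extendLabeling f (fun p => m + ℓ p)) (attachPendants G S s).edgeSet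
      (Set.Icc 1 (m + n)) := by
  have hfm : ∀ y ∈ G.edgeSet, 1 ≤ f y ∧ f y ≤ m := fun y hy => hf.mapsTo hy
  have hℓm : ∀ p, 1 ≤ ℓ p ∧ ℓ p ≤ n := fun p => hℓ.mapsTo (Set.mem_univ p)
  refine ⟨?_, ?_, ?_⟩
  · intro x hx
    rw [Set.mem_Icc]
    rcases mem_edgeSet_attachPendants.mp hx with ⟨y, hy, rfl⟩ | ⟨p, rfl⟩
    · have := hfm y hy
      rw [extendLabeling_map_inl]
      omega
    · have := hℓm p
      rw [extendLabeling_inl_inr]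
      omega
  · intro x hx x' hx' h
    rcases mem_edgeSet_attachPendants.mp hx with ⟨y, hy, rfl⟩ | ⟨p, rfl⟩ <;>
      rcases mem_edgeSet_attachPendants.mp hx' with ⟨y', hy', rfl⟩ | ⟨p', rfl⟩ <;>
      simp only [extendLabeling_map_inl, extendLabeling_inl_inr] at h
    · rw [hf.injOn hy hy' h]
    · have := hfm y hy
      have := hℓm p'
      omega
    · have := hfm y' hy'
      have := hℓm p
      omega
    · rw [hℓ.injOn (Set.mem_univ p) (Set.mem_univ p') (by omega)]
  · rintro a ⟨ha₁, ha₂⟩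
    by_cases ham : a ≤ m
    · obtain ⟨y, hy, rfl⟩ := hf.surjOn (show a ∈ Set.Icc 1 m from ⟨ha₁, ham⟩)
      exact ⟨y.map Sum.inl, mem_edgeSet_attachPendants.mpr (Or.inl ⟨y, hy, rfl⟩), by simp⟩
    · obtain ⟨p, -, hp⟩ := hℓ.surjOn (show a - m ∈ Set.Icc 1 n from ⟨by omega, by omega⟩)
      refine ⟨_, mem_edgeSet_attachPendants.mpr (Or.inr ⟨p, rfl⟩), ?_⟩
      rw [extendLabeling_inl_inr]
      omega

variable [Fintype V]

theorem vertexSum_attachPendants_inl (g : Sym2 (V ⊕ (S × Fin s)) → ℕ) (v : V) :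
    vertexSum (attachPendants G S s) g (Sum.inl v) =
      vertexSum G (fun y => g (y.map Sum.inl)) v +
        ∑ p : S × Fin s, if v = p.1 then g s(Sum.inl v, Sum.inr p) else 0 := by
  simp [vertexSum_eq_sum_ite, Fintype.sum_sum_type]

theorem vertexSum_attachPendants_inl_of_notMem (g : Sym2 (V ⊕ (S × Fin s)) → ℕ) {v : V}
    (hv : v ∉ S) : vertexSum (attachPendants G S s) g (Sum.inl v) =
      vertexSum G (fun y => g (y.map Sum.inl)) v := by
  rw [vertexSum_attachPendants_inl, Finset.sum_eq_zero, add_zero]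
  rintro p -
  refine if_neg ?_
  rintro rfl
  exact hv p.1.2

theorem vertexSum_attachPendants_inl_of_mem (g : Sym2 (V ⊕ (S × Fin s)) → ℕ) (w : S) :
    vertexSum (attachPendants G S s) g (Sum.inl ↑w) =
      vertexSum G (fun y => g (y.map Sum.inl)) w +
        ∑ k, g s(Sum.inl ↑w, Sum.inr (w, k)) := by
  rw [vertexSum_attachPendants_inl, Fintype.sum_prod_type, Fintype.sum_eq_single w]
  · simp
  · intro w' hw'
    refine Finset.sum_eq_zero fun k _ => if_neg fun h => hw' (Subtype.ext h.symm)

theorem vertexSum_attachPendants_inr (g : Sym2 (V ⊕ (S × Fin s)) → ℕ) (p : S × Fin s) :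
    vertexSum (attachPendants G S s) g (Sum.inr p) = g s(Sum.inl ↑p.1, Sum.inr p) := by
  simp [vertexSum_eq_sum_ite, Fintype.sum_sum_type, Sym2.eq_swap]

theorem pendantCount_add_le_pendantCount_attachPendants
    (hS : ∀ v ∈ S, ¬ IsPendant G v) :
    pendantCount G + s * S.card ≤ pendantCount (attachPendants G S s) := by
  have hcard : pendantCount G + s * S.card =
      ((univ.filter (IsPendant G)).disjSum (univ : Finset (S × Fin s))).card := by
    simp [pendantCount, Finset.card_disjSum, mul_comm]
  rw [hcard, pendantCount]
  refine Finset.card_le_card fun x hx => ?_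
  rw [Finset.mem_filter, IsPendant, degree_eq_vertexSum_one]
  refine ⟨mem_univ _, ?_⟩
  rcases x with v | p
  · have hv : IsPendant G v := by simpa using hx
    rw [vertexSum_attachPendants_inl_of_notMem _ (fun h => hS v h hv),
      ← degree_eq_vertexSum_one]
    exact hv
  · rw [vertexSum_attachPendants_inr]

end AttachPendants

/-- Entry in column `k` and row `x` of the boustrophedon filling of an array with `n` rows. -/
def snakeEntry (n k x : ℕ) : ℕ :=
  if Even k then k * n + (x + 1) else k * n + (n - x)

theorem snakeEntry_bounds {n k x : ℕ} (hx : x < n) :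
    k * n < snakeEntry n k x ∧ snakeEntry n k x ≤ (k + 1) * n := by
  rw [snakeEntry, add_mul, one_mul]
  split_ifs <;> omega

theorem snakeEntry_injective {n k k' x x' : ℕ} (hx : x < n) (hx' : x' < n)
    (h : snakeEntry n k x = snakeEntry n k' x') : k = k' ∧ x = x' := by
  have h₁ := snakeEntry_bounds (k := k) hx
  have h₂ := snakeEntry_bounds (k := k') hx'
  have hk : k = k' := by
    have h₃ : k < k' + 1 := lt_of_mul_lt_mul_right (by omega : k * n < (k' + 1) * n) (Nat.zero_le n)
    have h₄ : k' < k + 1 := lt_of_mul_lt_mul_right (by omega : k' * n < (k + 1) * n) (Nat.zero_le n)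
    omega
  subst hk
  refine ⟨rfl, ?_⟩
  simp only [snakeEntry] at h
  split_ifs at h <;> omega

theorem sum_snakeEntry_eq {n x x' : ℕ} (hx : x < n) (hx' : x' < n) (m : ℕ) :
    ∑ k ∈ Finset.range (m + m), snakeEntry n k x =
      ∑ k ∈ Finset.range (m + m), snakeEntry n k x' := by
  induction m with
  | zero => rfl
  | succ m ih =>
    have hodd : ¬ Even (m + m + 1) := by simp [Nat.even_add_one]
    rw [show m + 1 + (m + 1) = m + m + 1 + 1 by ring]
    rw [Finset.sum_range_succ, Finset.sum_range_succ, Finset.sum_range_succ,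
      Finset.sum_range_succ, ih]
    simp only [snakeEntry, if_neg hodd, if_pos (Even.add_self m)]
    omega

/-- An array with equal row sums, filled bijectively with `1, …, s * |ι|`. -/
theorem exists_bijOn_const_row_sum (ι : Type*) [Fintype ι] [Nonempty ι] {s : ℕ} (hs : 0 < s)
    (heven : 2 ≤ Fintype.card ι → Even s) :
    ∃ (ℓ : ι × Fin s → ℕ) (σ : ℕ), Set.BijOn ℓ Set.univ (Set.Icc 1 (s * Fintype.card ι)) ∧
      (∀ w, ∑ k, ℓ (w, k) = σ) ∧ s * Fintype.card ι ≤ σ := by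
  set n := Fintype.card ι with hn
  have hnpos : 0 < n := Fintype.card_pos
  let φ : ι ≃ Fin n := Fintype.equivFin ι
  let ℓ : ι × Fin s → ℕ := fun p => snakeEntry n p.2 (φ p.1)
  have hinj : Function.Injective ℓ := by
    rintro ⟨w, k⟩ ⟨w', k'⟩ h
    obtain ⟨h₁, h₂⟩ := snakeEntry_injective (φ w).2 (φ w').2 h
    exact Prod.ext (φ.injective (Fin.ext h₂)) (Fin.ext h₁)
  have himage : Finset.univ.image ℓ = Finset.Icc 1 (s * n) := by
    refine Finset.eq_of_subset_of_card_le ?_ ?_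
    · intro a ha
      obtain ⟨⟨w, k⟩, -, rfl⟩ := Finset.mem_image.mp ha
      obtain ⟨h₁, h₂⟩ := snakeEntry_bounds (k := k) (φ w).2
      have h₃ : (k + 1 : ℕ) * n ≤ s * n := Nat.mul_le_mul_right n k.2
      exact Finset.mem_Icc.mpr ⟨by simp only [ℓ]; omega, h₂.trans h₃⟩
    · rw [Finset.card_image_of_injective _ hinj]
      simp [← hn, mul_comm]
  have hbij : Set.BijOn ℓ Set.univ (Set.Icc 1 (s * n)) := by
    have h := hinj.injOn.bijOn_image (s := Set.univ)
    rwa [← Finset.coe_univ, ← Finset.coe_image, himage, Finset.coe_Icc, Finset.coe_univ] at h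
  have hrow : ∀ w w', ∑ k, ℓ (w, k) = ∑ k, ℓ (w', k) := by
    intro w w'
    rcases Nat.lt_or_ge n 2 with hlt | hge
    · have : Subsingleton ι := Fintype.card_le_one_iff_subsingleton.mp (by omega)
      rw [Subsingleton.elim w w']
    · obtain ⟨m, rfl⟩ := heven hge
      simp only [ℓ]
      rw [Fin.sum_univ_eq_sum_range (fun k => snakeEntry n k (φ w)),
        Fin.sum_univ_eq_sum_range (fun k => snakeEntry n k (φ w'))]
      exact sum_snakeEntry_eq (φ w).2 (φ w').2 m
  obtain ⟨⟨w, k⟩, -, hwk⟩ := hbij.surjOn (Set.right_mem_Icc.mpr (Nat.mul_pos hs hnpos))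
  refine ⟨ℓ, ∑ k, ℓ (w, k), hbij, fun w' => hrow w' w, ?_⟩
  rw [← hwk]
  exact Finset.single_le_sum (f := fun k => ℓ (w, k)) (fun _ _ => Nat.zero_le _) (mem_univ k)

namespace StandardSetup

variable [Fintype V] {G : SimpleGraph V} {f : Sym2 V → ℕ} {t r : ℕ} {Vset : ℕ → Finset V}
  {c : ℕ → ℕ}

theorem disjoint_class (h : StandardSetup G f t r Vset c) {a b : ℕ} (ha : a ∈ Finset.Icc 1 t)
    (hb : b ∈ Finset.Icc 1 t) (hab : a ≠ b) : Disjoint (Vset a) (Vset b) := by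
  rw [Finset.disjoint_left]
  intro v hva hvb
  exact h.color_injective a ha b hb hab
    ((h.color_on_class a ha v hva).symm.trans (h.color_on_class b hb v hvb))

theorem pendantsInLow_add_le_pendantCount (h : StandardSetup G f t r Vset c) :
    pendantsInLow G Vset r + (t - r) ≤ pendantCount G := by
  have hrt := h.r_le_t
  have hhigh : ((Finset.Icc (r + 1) t).biUnion Vset).card = t - r := by
    rw [Finset.card_biUnion, Finset.sum_congr rfl (g := fun _ => 1)]
    · simp
    · intro a ha
      obtain ⟨v, -, hv⟩ := h.pendant_singleton a ha
      simp [hv]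
    · intro a ha b hb hab
      rw [Finset.mem_coe, Finset.mem_Icc] at ha hb
      exact h.disjoint_class (Finset.mem_Icc.mpr (by omega)) (Finset.mem_Icc.mpr (by omega)) hab
  rw [pendantsInLow, ← hhigh, ← Finset.card_union_of_disjoint, pendantCount]
  · refine Finset.card_le_card (Finset.union_subset ?_ ?_)
    · exact Finset.filter_subset_filter _ (Finset.subset_univ _)
    · intro v hv
      obtain ⟨a, ha, hva⟩ := Finset.mem_biUnion.mp hv
      obtain ⟨u, hu, hVa⟩ := h.pendant_singleton a ha
      rw [hVa, Finset.mem_singleton] at hva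
      simpa [hva] using hu
  · refine Finset.disjoint_of_subset_left (Finset.filter_subset _ _) ?_
    rw [Finset.disjoint_biUnion_left]
    intro a ha
    rw [Finset.disjoint_biUnion_right]
    intro b hb
    rw [Finset.mem_Icc] at ha hb
    exact h.disjoint_class (Finset.mem_Icc.mpr (by omega)) (Finset.mem_Icc.mpr (by omega))
      (by omega)

theorem c_le_of_lt (h : StandardSetup G f t r Vset c) {a : ℕ} (ha₁ : r < a) (ha₂ : a ≤ t) :
    c a ≤ G.edgeFinset.card := by
  obtain ⟨v, hv, hVa⟩ := h.pendant_singleton a (Finset.mem_Icc.mpr ⟨ha₁, ha₂⟩)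
  rw [← h.color_on_class a (Finset.mem_Icc.mpr ⟨by omega, ha₂⟩) v (by simp [hVa])]
  exact h.antimagic.vertexSum_le hv

theorem c_le_c (h : StandardSetup G f t r Vset c) {a b : ℕ} (ha : 1 ≤ a) (hab : a ≤ b)
    (hb : b ≤ r) : c a ≤ c b := by
  rcases hab.eq_or_lt with rfl | hlt
  · rfl
  · exact (h.c_strictMono_low a b ha hlt hb).le

end StandardSetup

/-- Theorem 2.1(3)(c): in the standard setup with `r ≥ 2`, if
`c_{j-1} ≤ e < c_j` for some `3 ≤ j ≤ r`, and `j ≤ i ≤ r` with `e + s·nᵢ ≥ c_r`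
when `i < r` and `e + s·nᵢ ≥ c_{r-1}` when `i = r`, where `s ≥ 1` if `nᵢ = 1`
and `s ≥ 2` is even if `nᵢ ≥ 2`, then
`s·nᵢ + t - r + b + 1 ≤ χ_la(G(Vᵢ, s)) ≤ s·nᵢ + t - r + j`. -/
theorem chiLA_attachPendants_bounds_high_class [Fintype V] (G : SimpleGraph V)
    (f : Sym2 V → ℕ) (t r : ℕ) (Vset : ℕ → Finset V) (c : ℕ → ℕ)
    (setup : StandardSetup G f t r Vset c) (hr : 2 ≤ r)
    (e s i j b : ℕ) (he : G.edgeFinset.card = e)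
    (hb : pendantsInLow G Vset r = b)
    (hj₁ : 3 ≤ j) (hj₂ : j ≤ r)
    (hce₁ : c (j - 1) ≤ e) (hce₂ : e < c j)
    (hi₁ : j ≤ i) (hi₂ : i ≤ r)
    (hbig₁ : i < r → c r ≤ e + s * (Vset i).card)
    (hbig₂ : i = r → c (r - 1) ≤ e + s * (Vset i).card)
    (hs₁ : (Vset i).card = 1 → 1 ≤ s)
    (hs₂ : 2 ≤ (Vset i).card → 2 ≤ s ∧ Even s) :
    s * (Vset i).card + (t - r) + b + 1 ≤ chiLA (attachPendants G (Vset i) s) ∧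
    chiLA (attachPendants G (Vset i) s) ≤ s * (Vset i).card + (t - r) + j := by
  subst he hb
  have hrt := setup.r_le_t
  have hit : i ∈ Finset.Icc 1 t := Finset.mem_Icc.mpr (by omega)
  have hci : G.edgeFinset.card < c i := hce₂.trans_le (setup.c_le_c (by omega) hi₁ hi₂)
  have hnpos : 0 < (Vset i).card := (setup.class_nonempty i hit).card_pos
  have hspos : 0 < s := by
    rcases Nat.lt_or_ge (Vset i).card 2 with h | h
    · exact hs₁ (by omega)
    · have := (hs₂ h).1
      omega
  have hother : ∀ a ∈ Finset.Icc 1 t, a ≠ i →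
      c a ≤ G.edgeFinset.card + s * (Vset i).card := by
    intro a ha hai
    rw [Finset.mem_Icc] at ha
    rcases Nat.lt_or_ge r a with har | har
    · exact (setup.c_le_of_lt har ha.2).trans (Nat.le_add_right _ _)
    · rcases hi₂.eq_or_lt with hir | hir
      · exact (setup.c_le_c ha.1 (by omega) (by omega)).trans (hbig₂ hir)
      · exact (setup.c_le_c ha.1 har le_rfl).trans (hbig₁ hir)
  have : Nonempty (Vset i) := (setup.class_nonempty i hit).to_subtype
  obtain ⟨ℓ, σ, hℓ, hrow, hσ⟩ := exists_bijOn_const_row_sum (Vset i) hspos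
    (fun h => (hs₂ (by simpa using h)).2)
  rw [Fintype.card_coe] at hℓ hσ
  set n := s * (Vset i).card with hn
  set q := G.edgeFinset.card with hq
  set H := attachPendants G (Vset i) s with hH
  set g := extendLabeling f (fun p => q + ℓ p) with hg
  have hbij : Set.BijOn g H.edgeSet (Set.Icc 1 (q + n)) :=
    bijOn_extendLabeling setup.antimagic.1 hℓ
  have hcard : H.edgeFinset.card = q + n := card_edgeFinset_of_bijOn hbij
  have hsum_notMem : ∀ v ∉ Vset i, vertexSum H g (Sum.inl v) = vertexSum G f v := by
    intro v hv
    simp [hH, hg, vertexSum_attachPendants_inl_of_notMem _ hv]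
  have hsum_mem : ∀ v ∈ Vset i, vertexSum H g (Sum.inl v) = c i + (s * q + σ) := by
    intro v hv
    have h := vertexSum_attachPendants_inl_of_mem (G := G) g ⟨v, hv⟩
    simpa [hg, Finset.sum_add_distrib, hrow, setup.color_on_class i hit v hv] using h
  have hsum_inr : ∀ p, vertexSum H g (Sum.inr p) = q + ℓ p := by
    intro p
    simp [hH, hg, vertexSum_attachPendants_inr]
  have hℓle : ∀ p, 1 ≤ ℓ p ∧ ℓ p ≤ n := fun p => hℓ.mapsTo (Set.mem_univ p)
  have hclass : ∀ v ∉ Vset i, ∃ a ∈ Finset.Icc 1 t, a ≠ i ∧ vertexSum H g (Sum.inl v) = c a := by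
    intro v hv
    obtain ⟨a, ha, hva⟩ := setup.class_cover v
    refine ⟨a, ha, ?_, (hsum_notMem v hv).trans (setup.color_on_class a ha v hva)⟩
    rintro rfl
    exact hv hva
  have hlt : ∀ v ∈ Vset i, ∀ u ∉ Vset i,
      vertexSum H g (Sum.inl u) < vertexSum H g (Sum.inl v) := by
    intro v hv u hu
    obtain ⟨a, ha, hai, h⟩ := hclass u hu
    have := hother a ha hai
    rw [hsum_mem v hv, h]
    omega
  have hlt_inr : ∀ p, vertexSum H g (Sum.inr p) < vertexSum H g (Sum.inl ↑p.1) := by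
    intro p
    have := hℓle p
    rw [hsum_inr, hsum_mem _ p.1.2]
    omega
  have hanti : IsLocalAntimagic H g := by
    refine ⟨by rwa [hcard], ?_⟩
    rintro (u | p) (v | p') hadj
    · rw [hH, attachPendants_adj_inl_inl] at hadj
      have hne := setup.antimagic.2 hadj
      by_cases hu : u ∈ Vset i <;> by_cases hv : v ∈ Vset i
      · exact absurd ((setup.color_on_class i hit u hu).trans
          (setup.color_on_class i hit v hv).symm) hne
      · exact (hlt u hu v hv).ne'
      · exact (hlt v hv u hu).ne
      · rwa [hsum_notMem u hu, hsum_notMem v hv]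
    · rw [hH, attachPendants_adj_inl_inr] at hadj
      exact hadj ▸ (hlt_inr p').ne'
    · rw [hH, attachPendants_adj_inr_inl] at hadj
      exact hadj ▸ (hlt_inr p).ne
    · exact absurd hadj attachPendants_not_adj_inr_inr
  have hcolor : colorCount H g ≤ n + (t - r) + j := by
    have hsub : Finset.univ.image (vertexSum H g) ⊆
        ((Finset.Icc (q + 1) (q + n) ∪ (Finset.Icc (r + 1) t).image c) ∪
          (Finset.Icc 1 (j - 1)).image c) ∪ {c i + (s * q + σ)} := by
      intro a ha
      simp only [Finset.mem_union, Finset.mem_image, Finset.mem_Icc, Finset.mem_singleton]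
      obtain ⟨u | p, -, rfl⟩ := Finset.mem_image.mp ha
      · by_cases hu : u ∈ Vset i
        · exact Or.inr (hsum_mem u hu)
        · obtain ⟨a, hat, hai, h⟩ := hclass u hu
          have hle := hother a hat hai
          rw [Finset.mem_Icc] at hat
          rw [h]
          rcases Nat.lt_or_ge r a with har | har
          · exact Or.inl (Or.inl (Or.inr ⟨a, ⟨har, hat.2⟩, rfl⟩))
          · rcases Nat.lt_or_ge a j with haj | haj
            · exact Or.inl (Or.inr ⟨a, ⟨hat.1, by omega⟩, rfl⟩)
            · have := setup.c_le_c (by omega) haj har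
              exact Or.inl (Or.inl (Or.inl ⟨by omega, hle⟩))
      · have := hℓle p
        rw [hsum_inr]
        exact Or.inl (Or.inl (Or.inl (by omega)))
    have h₁ := Finset.card_image_le (s := Finset.Icc (r + 1) t) (f := c)
    have h₂ := Finset.card_image_le (s := Finset.Icc 1 (j - 1)) (f := c)
    rw [Nat.card_Icc] at h₁ h₂
    refine (Finset.card_le_card hsub).trans ((Finset.card_union_le _ _).trans ?_)
    have h₃ := Finset.card_union_le
      (Finset.Icc (q + 1) (q + n) ∪ (Finset.Icc (r + 1) t).image c)
      ((Finset.Icc 1 (j - 1)).image c)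
    have h₄ := Finset.card_union_le (Finset.Icc (q + 1) (q + n)) ((Finset.Icc (r + 1) t).image c)
    rw [Nat.card_Icc] at h₄
    rw [Finset.card_singleton]
    omega
  have hmem : colorCount H g ∈ {m | ∃ g', IsLocalAntimagic H g' ∧ colorCount H g' = m} :=
    ⟨g, hanti, rfl⟩
  constructor
  · refine le_csInf ⟨_, hmem⟩ ?_
    rintro _ ⟨g', hg', rfl⟩
    have h₁ := hg'.pendantCount_lt_colorCount (by have := setup.two_le_card_edges; omega)
    have h₂ : pendantCount G + n ≤ pendantCount H :=
      pendantCount_add_le_pendantCount_attachPendants fun v hv hpend => by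
        have := setup.antimagic.vertexSum_le hpend
        rw [setup.color_on_class i hit v hv] at this
        omega
    have h₃ := setup.pendantsInLow_add_le_pendantCount
    omega
  · exact (Nat.sInf_le hmem).trans hcolor

end LocalAntimagic
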